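/- Let R = ℂ⟦x₁,…,xₙ⟧, let 1 ≤ k < n, let A be a k×n matrix with entries in R, and let I_k(A) ⊆ R be the ideal generated by all k×k minors of A. Assume the Krull dimension of R/I_k(A) equals k−1. For every subset S = {j₀ < j₁ < ⋯ < j_k} of {1,…,n} with k+1 elements, let v_S ∈ Rⁿ be the vector whose j_s-th entry is (−1)^s · det(A_S^s) for s = 0,…,k, where A_S^s is the k×k submatrix of A formed by the columns indexed by S ∖ {j_s}, and whose remaining entries are 0. Then the kernel of the R-linear map Rⁿ → R^k determined by A is exactly the R-submodule of Rⁿ generated by the vectors v_S over all such subsets S. -/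

import Mathlib

open CategoryTheory Abelian

universe u

/-- Vanishing of `Ext^j(N, M)` for all `j < t` and all modules `N` annihilated by `I`. -/
def ExtVanishing {R : Type u} [CommRing R] (I : Ideal R) (M : Type u) [AddCommGroup M] [Module R M]
    (t : ℕ) : Prop :=
  ∀ N : ModuleCat.{u} R, I ≤ Module.annihilator R N →
    ∀ j < t, ∀ x : Ext N (ModuleCat.of R M) j, x = 0

namespace ExtVanishing

variable {R : Type u} [CommRing R] {I : Ideal R}
  {A B C : Type u} [AddCommGroup A] [Module R A] [AddCommGroup B] [Module R B]
  [AddCommGroup C] [Module R C] {s t : ℕ}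

theorem zero (M : Type u) [AddCommGroup M] [Module R M] : ExtVanishing I M 0 :=
  fun _ _ _ hj => absurd hj (Nat.not_lt_zero _)

theorem mono (h : ExtVanishing I A t) (hst : s ≤ t) : ExtVanishing I A s :=
  fun N hN j hj => h N hN j (hj.trans_le hst)

theorem of_subsingleton [Subsingleton A] : ExtVanishing I A t := fun N _ j _ x => by
  have h : (𝟙 (ModuleCat.of R A)) = 0 := by
    ext a
    exact Subsingleton.elim (α := A) _ _
  rw [← x.comp_mk₀_id, h, Ext.mk₀_zero, Ext.comp_zero]

/-- The short complex of modules attached to an exact pair of linear maps. -/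
noncomputable abbrev shortComplex {f : A →ₗ[R] B} {g : B →ₗ[R] C} (hfg : Function.Exact f g) :
    ShortComplex (ModuleCat.{u} R) :=
  ShortComplex.mk (ModuleCat.ofHom f) (ModuleCat.ofHom g) (by
    ext x; exact hfg.apply_apply_eq_zero x)

theorem shortComplex_shortExact {f : A →ₗ[R] B} {g : B →ₗ[R] C} (hf : Function.Injective f)
    (hfg : Function.Exact f g) (hg : Function.Surjective g) : (shortComplex hfg).ShortExact where
  exact := (ShortComplex.ShortExact.moduleCat_exact_iff_function_exact _).2 hfg
  mono_f := (ModuleCat.mono_iff_injective _).2 hf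
  epi_g := (ModuleCat.epi_iff_surjective _).2 hg

theorem right {f : A →ₗ[R] B} {g : B →ₗ[R] C} (hf : Function.Injective f)
    (hfg : Function.Exact f g) (hg : Function.Surjective g)
    (hA : ExtVanishing I A (t + 1)) (hB : ExtVanishing I B t) : ExtVanishing I C t := by
  intro N hN j hj x
  obtain ⟨y, rfl⟩ := Ext.covariant_sequence_exact₃ N (shortComplex_shortExact hf hfg hg) x rfl
    (hA N hN (j + 1) (by lia) _)
  rw [hB N hN j hj y, Ext.zero_comp]

theorem middle {f : A →ₗ[R] B} {g : B →ₗ[R] C} (hf : Function.Injective f)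
    (hfg : Function.Exact f g) (hg : Function.Surjective g)
    (hA : ExtVanishing I A t) (hC : ExtVanishing I C t) : ExtVanishing I B t := by
  intro N hN j hj x
  obtain ⟨y, rfl⟩ := Ext.covariant_sequence_exact₂ N (shortComplex_shortExact hf hfg hg) x
    (hC N hN j hj _)
  rw [hA N hN j hj y, Ext.zero_comp]

theorem of_injective_one {f : A →ₗ[R] B} (hf : Function.Injective f) (hB : ExtVanishing I B 1) :
    ExtVanishing I A 1 := by
  intro N hN j hj x
  obtain rfl : j = 0 := by lia
  have : Mono (ModuleCat.ofHom f) := (ModuleCat.mono_iff_injective _).2 hf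
  apply Ext.postcomp_mk₀_injective_of_mono N (ModuleCat.ofHom f)
  rw [hB N hN 0 hj ((Ext.mk₀ (ModuleCat.ofHom f)).postcomp N (add_zero 0) x), map_zero]

theorem congr (e : A ≃ₗ[R] B) (hA : ExtVanishing I A t) : ExtVanishing I B t := by
  intro N hN j hj x
  have h := hA N hN j hj (x.comp (Ext.mk₀ e.toModuleIso.inv) (add_zero j))
  have := congrArg (fun y => Ext.comp y (Ext.mk₀ e.toModuleIso.hom) (add_zero j)) h
  rwa [Ext.comp_assoc_of_third_deg_zero, Ext.mk₀_comp_mk₀, Iso.inv_hom_id, Ext.comp_mk₀_id,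
    Ext.zero_comp] at this

theorem of_smul {g : B →ₗ[R] C} {r : R} (hr : r ∈ I) (hreg : IsSMulRegular B r)
    (hfg : Function.Exact (LinearMap.lsmul R B r) g) (hg : Function.Surjective g)
    (hC : ExtVanishing I C t) : ExtVanishing I B (t + 1) := by
  intro N hN j hj x
  have hS := shortComplex_shortExact (f := LinearMap.lsmul R B r) hreg hfg hg
  have hx : x.comp (Ext.mk₀ (shortComplex hfg).f) (add_zero j) = 0 := by
    have := Ext.postcomp_smul_id_eq_zero_of_mem_annihilator (M := ModuleCat.of R B) (hN hr) j
    exact congrArg (fun f => f.hom x) this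
  cases j with
  | zero =>
    have := hS.mono_f
    apply Ext.postcomp_mk₀_injective_of_mono N (shortComplex hfg).f
    simpa using hx
  | succ j =>
    obtain ⟨y, rfl⟩ := Ext.covariant_sequence_exact₁ N hS x hx rfl
    rw [hC N hN j (by lia) y, Ext.zero_comp]

theorem eq_zero_of_forall_smul_eq_zero (hA : ExtVanishing I A 1) (a : A)
    (ha : ∀ r ∈ I, r • a = 0) : a = 0 := by
  have hN : I ≤ Module.annihilator R (Submodule.span R {a}) := by
    intro r hr
    rw [Submodule.mem_annihilator_span_singleton]
    exact ha r hr
  have h := hA (ModuleCat.of R (Submodule.span R {a})) hN 0 one_pos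
    (Ext.mk₀ (ModuleCat.ofHom (Submodule.span R {a}).subtype))
  rw [Ext.mk₀_eq_zero_iff] at h
  have := congrArg (fun f => f.hom ⟨a, Submodule.mem_span_singleton_self a⟩) h
  simpa using this

theorem eq_of_smul_le {B' Z : Submodule R A} (hBZ : B' ≤ Z) (hA : ExtVanishing I A 1)
    (hB : ExtVanishing I B' 2) (hIZ : ∀ r ∈ I, ∀ z ∈ Z, r • z ∈ B') : B' = Z := by
  refine le_antisymm hBZ fun z hz => ?_
  have hQ : ExtVanishing I (Z ⧸ B'.submoduleOf Z) 1 := by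
    refine right (f := Submodule.inclusion hBZ) (g := (B'.submoduleOf Z).mkQ)
      (Submodule.inclusion_injective _) ?_ (Submodule.mkQ_surjective _) hB
      (hA.of_injective_one Z.injective_subtype)
    rw [LinearMap.exact_iff, Submodule.ker_mkQ, Submodule.range_inclusion]
    rfl
  have := hQ.eq_zero_of_forall_smul_eq_zero ((B'.submoduleOf Z).mkQ ⟨z, hz⟩) fun r hr => by
    rw [← map_smul, ← LinearMap.mem_ker, Submodule.ker_mkQ]
    exact hIZ r hr z hz
  rwa [← LinearMap.mem_ker, Submodule.ker_mkQ] at this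

theorem pi (hR : ExtVanishing I R t) (m : ℕ) : ExtVanishing I (Fin m → R) t := by
  induction m with
  | zero => exact of_subsingleton
  | succ m ih =>
    refine middle (f := LinearMap.single R (fun _ : Fin (m + 1) => R) 0)
      (g := LinearMap.funLeft R R Fin.succ) (Pi.single_injective (M := fun _ : Fin (m + 1) => R) 0) ?_
      (LinearMap.funLeft_surjective_of_injective _ _ _ (Fin.succ_injective m)) hR ih
    intro v
    constructor
    · intro h
      refine ⟨v 0, funext fun i => ?_⟩
      refine Fin.cases ?_ (fun i => ?_) i
      · simp
      · simpa using (congrFun h i).symm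
    · rintro ⟨r, rfl⟩
      ext i
      simp [LinearMap.funLeft]

theorem of_free [Nontrivial R] [Module.Free R A] [Module.Finite R A] (hR : ExtVanishing I R t) :
    ExtVanishing I A t :=
  (pi hR _).congr (Module.finBasis R A).equivFun.symm

end ExtVanishing

section Depth

open IsLocalRing Pointwise

variable {R : Type u} [CommRing R] [IsNoetherianRing R]
  {M : Type u} [AddCommGroup M] [Module R M]

theorem exists_isSMulRegular_of_forall_not_le [Module.Finite R M] {I : Ideal R}
    (h : ∀ P : Ideal R, IsAssociatedPrime P M → ¬ I ≤ P) : ∃ r ∈ I, IsSMulRegular M r := by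
  by_contra! hI
  have hsub : (I : Set R) ⊆ ⋃ P ∈ associatedPrimes R M, (P : Set R) := by
    rw [biUnion_associatedPrimes_eq_compl_regular R M]
    exact hI
  obtain ⟨P, hP, hIP⟩ := (Ideal.subset_union_prime_finite (f := id)
    (associatedPrimes.finite R M) 0 0 fun P hP _ _ => IsAssociatedPrime.isPrime hP).1 hsub
  exact h P hP hIP

theorem IsAssociatedPrime.exists_forall_smul_eq_zero {P : Ideal R} (hP : IsAssociatedPrime P M) :
    ∃ m : M, m ≠ 0 ∧ ∀ r ∈ P, r • m = 0 := by
  obtain ⟨hp, m, rfl⟩ := isAssociatedPrime_iff.1 hP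
  refine ⟨m, ?_, fun r hr => by simpa using hr⟩
  rintro rfl
  exact hp.ne_top (by simp)

variable [IsLocalRing R]

theorem IsAssociatedPrime.exists_quotient [Module.Finite R M] {P : Ideal R}
    (hP : IsAssociatedPrime P M) {x : R}
    (hx : x ∈ maximalIdeal R) (hreg : IsSMulRegular M x) :
    ∃ Q : Ideal R, IsAssociatedPrime Q (M ⧸ x • (⊤ : Submodule R M)) ∧ P ≤ Q ∧ x ∈ Q := by
  let U : Submodule R M := Submodule.torsionBySet R M P
  have hU : ∃ u ∈ U, u ∉ x • (⊤ : Submodule R M) := by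
    by_contra! hle
    have hbot : U = ⊥ := by
      refine Submodule.eq_bot_of_le_smul_of_le_jacobson_bot (Ideal.span {x}) U
        (IsNoetherian.noetherian U) (fun u hu => ?_)
        (by rwa [IsLocalRing.jacobson_eq_maximalIdeal _ bot_ne_top, Ideal.span_singleton_le_iff_mem])
      obtain ⟨m, -, rfl⟩ := (Submodule.mem_smul_pointwise_iff_exists _ _ _).1 (hle u hu)
      refine Submodule.smul_mem_smul (Ideal.mem_span_singleton_self x) ?_
      rw [Submodule.mem_torsionBySet_iff] at hu ⊢
      intro a
      apply hreg
      change x • (a : R) • m = x • (0 : M)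
      rw [smul_zero, smul_comm]
      exact hu a
    obtain ⟨m, hm, hPm⟩ := hP.exists_forall_smul_eq_zero
    have : m ∈ U := (Submodule.mem_torsionBySet_iff _ _).2 fun a => hPm a a.2
    rw [hbot] at this
    exact hm this
  obtain ⟨u, hu, hux⟩ := hU
  obtain ⟨Q, hQ, hle⟩ := exists_le_isAssociatedPrime_of_isNoetherianRing R
    (Submodule.Quotient.mk u : M ⧸ x • (⊤ : Submodule R M))
    (by rwa [Ne, Submodule.Quotient.mk_eq_zero])
  refine ⟨Q, hQ, fun r hr => hle ?_, hle ?_⟩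
  · rw [Submodule.mem_colon_singleton, ← Submodule.Quotient.mk_smul,
      (Submodule.mem_torsionBySet_iff _ _).1 hu ⟨r, hr⟩, Submodule.Quotient.mk_zero]
    exact Submodule.zero_mem _
  · rw [Submodule.mem_colon_singleton, ← Submodule.Quotient.mk_smul, Submodule.mem_bot,
      Submodule.Quotient.mk_eq_zero]
    exact Submodule.smul_mem_pointwise_smul _ _ _ trivial

theorem ExtVanishing.le_ringKrullDim_quotient {t : ℕ} {M : Type u} [AddCommGroup M] [Module R M]
    [Module.Finite R M] (h : ExtVanishing (maximalIdeal R) M t)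
    {P : Ideal R} (hP : IsAssociatedPrime P M) : (t : WithBot ℕ∞) ≤ ringKrullDim (R ⧸ P) := by
  induction t generalizing M P with
  | zero =>
    have := hP.isPrime
    exact ringKrullDim_nonneg_of_nontrivial
  | succ t ih =>
    obtain ⟨x, hx, hreg⟩ := exists_isSMulRegular_of_forall_not_le (M := M) (I := maximalIdeal R)
      fun Q hQ hle => by
        obtain ⟨m, hm, hQm⟩ := hQ.exists_forall_smul_eq_zero
        exact hm ((h.mono (by lia)).eq_zero_of_forall_smul_eq_zero m fun r hr => hQm r (hle hr))
    obtain ⟨Q, hQ, hPQ, hxQ⟩ := hP.exists_quotient hx hreg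
    have hquot := ih (h.right (f := LinearMap.lsmul R M x) hreg (LinearMap.exact_lsmul_mkQ_smul_top M x)
      (Submodule.mkQ_surjective _) (h.mono (Nat.le_succ t))) hQ
    have hPp := hP.isPrime
    have hxP : x ∉ P := fun hxP => by
      obtain ⟨m, hm, hPm⟩ := hP.exists_forall_smul_eq_zero
      exact hm (hreg ((hPm x hxP).trans (smul_zero x).symm))
    have hdim : ringKrullDim (R ⧸ Q) + 1 ≤ ringKrullDim (R ⧸ P) := by
      refine ringKrullDim_succ_le_of_surjective (Ideal.Quotient.factor hPQ)
        (Ideal.Quotient.factor_surjective hPQ) (r := Ideal.Quotient.mk P x) ?_ ?_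
      · exact mem_nonZeroDivisors_of_ne_zero (by rwa [Ne, Ideal.Quotient.eq_zero_iff_mem])
      · simpa [Ideal.Quotient.eq_zero_iff_mem] using hxQ
    push_cast
    exact (add_le_add_left hquot 1).trans hdim

/-- If `M` has depth at least `d + s`, then the grade of `I` on `M` is at least `s` as soon as
`dim R ⧸ P ≤ d` for all primes `P` containing `I`. -/
theorem ExtVanishing.of_ringKrullDim_le {d s : ℕ} {M : Type u} [AddCommGroup M] [Module R M]
    [Module.Finite R M] (h : ExtVanishing (maximalIdeal R) M (d + s)) {I : Ideal R}
    (hd : ∀ P : Ideal R, P.IsPrime → I ≤ P → ringKrullDim (R ⧸ P) ≤ d) :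
    ExtVanishing I M s := by
  induction s generalizing M with
  | zero => exact .zero M
  | succ s ih =>
    obtain ⟨x, hx, hreg⟩ := exists_isSMulRegular_of_forall_not_le (M := M) (I := I)
      fun P hP hle => by
        have := (h.le_ringKrullDim_quotient hP).trans (hd P hP.isPrime hle)
        norm_cast at this
        lia
    have hex := LinearMap.exact_lsmul_mkQ_smul_top M x
    exact of_smul hx hreg hex (Submodule.mkQ_surjective _) <|
      ih <| h.right (f := LinearMap.lsmul R M x) hreg hex (Submodule.mkQ_surjective _) (h.mono (by lia))

end Depth

section PowerSeries

variable {K : Type u} [Field K] {n : ℕ}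

/-- The power series all of whose monomials involve one of the first `i` variables. -/
def MvPowerSeries.initialVarsIdeal (K : Type u) [Field K] (n i : ℕ) :
    Ideal (MvPowerSeries (Fin n) K) where
  carrier := {f | ∀ m : Fin n →₀ ℕ, (∀ j : Fin n, (j : ℕ) < i → m j = 0) → coeff m f = 0}
  zero_mem' := fun m _ => by simp
  add_mem' := fun hf hg m hm => by simp [hf m hm, hg m hm]
  smul_mem' := fun c f hf m hm => by
    classical
    rw [smul_eq_mul, coeff_mul]
    refine Finset.sum_eq_zero fun p hp => ?_
    rw [hf p.2 fun j hj => ?_, mul_zero]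
    have := congrArg (fun q : Fin n →₀ ℕ => q j) (Finset.HasAntidiagonal.mem_antidiagonal.1 hp)
    simp only [Finsupp.add_apply, hm j hj] at this
    lia

namespace MvPowerSeries

theorem X_mul_mem_initialVarsIdeal_iff (i : Fin n) (f : MvPowerSeries (Fin n) K) :
    X i * f ∈ initialVarsIdeal K n i ↔ f ∈ initialVarsIdeal K n i := by
  refine ⟨fun h m hm => ?_, fun h => Ideal.mul_mem_left _ _ h⟩
  rw [← one_mul (coeff m f), ← coeff_add_monomial_mul (Finsupp.single i 1)]
  refine h _ fun j hj => ?_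
  have : i ≠ j := by rintro rfl; exact lt_irrefl _ hj
  simp [hm j hj, this]

theorem initialVarsIdeal_le_succ (i : ℕ) : initialVarsIdeal K n i ≤ initialVarsIdeal K n (i + 1) :=
  fun _ hf m hm => hf m fun j hj => hm j (by lia)

theorem X_mem_initialVarsIdeal_succ (i : Fin n) : X i ∈ initialVarsIdeal K n (i + 1) := by
  classical
  intro m hm
  rw [coeff_X, if_neg]
  rintro rfl
  simpa using hm i (Nat.lt_succ_self _)

theorem exists_sub_X_mul_mem_initialVarsIdeal (i : Fin n) {f : MvPowerSeries (Fin n) K}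
    (hf : f ∈ initialVarsIdeal K n (i + 1)) : ∃ q, f - X i * q ∈ initialVarsIdeal K n i := by
  classical
  let q : MvPowerSeries (Fin n) K := fun m => coeff (m + Finsupp.single i 1) f
  have hq (m) : coeff m q = coeff (m + Finsupp.single i 1) f := rfl
  refine ⟨q, fun m hm => ?_⟩
  rw [map_sub, X, coeff_monomial_mul, one_mul]
  split_ifs with h
  · rw [hq, tsub_add_cancel_of_le h, sub_self]
  · rw [sub_zero]
    refine hf m fun j hj => ?_
    rcases (Nat.lt_succ_iff.1 hj).lt_or_eq with hj | hj
    · exact hm j hj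
    · obtain rfl := Fin.ext hj
      rw [Finsupp.single_le_iff] at h
      lia

open IsLocalRing in
theorem extVanishing_quotient_initialVarsIdeal (i : ℕ) (hi : i ≤ n) :
    ExtVanishing (maximalIdeal (MvPowerSeries (Fin n) K))
      (MvPowerSeries (Fin n) K ⧸ initialVarsIdeal K n i) (n - i) := by
  induction hi using Nat.decreasingInduction with
  | self =>
    rw [Nat.sub_self]
    exact .zero _
  | of_succ i hi ih =>
    have hX : (X ⟨i, hi⟩ : MvPowerSeries (Fin n) K) ∈
        maximalIdeal (MvPowerSeries (Fin n) K) := by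
      rw [mem_maximalIdeal, mem_nonunits_iff, isUnit_iff_constantCoeff]
      simp
    have hfac := initialVarsIdeal_le_succ (K := K) (n := n) i
    rw [show n - i = n - (i + 1) + 1 by lia]
    refine ExtVanishing.of_smul (g := Submodule.factor hfac) hX ?_ ?_
      (Submodule.factor_surjective hfac) ih
    · rw [isSMulRegular_iff_right_eq_zero_of_smul]
      intro f hf
      obtain ⟨f, rfl⟩ := Submodule.Quotient.mk_surjective _ f
      rw [← Submodule.Quotient.mk_smul, Submodule.Quotient.mk_eq_zero] at hf
      rw [Submodule.Quotient.mk_eq_zero]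
      exact (X_mul_mem_initialVarsIdeal_iff ⟨i, hi⟩ f).1 hf
    · intro f
      obtain ⟨f, rfl⟩ := Submodule.Quotient.mk_surjective _ f
      constructor
      · intro hf
        obtain ⟨q, hq⟩ := exists_sub_X_mul_mem_initialVarsIdeal ⟨i, hi⟩
          ((Submodule.Quotient.mk_eq_zero _).1 hf)
        refine ⟨Submodule.Quotient.mk q, ?_⟩
        exact ((Submodule.Quotient.eq _).2 hq).symm
      · rintro ⟨q, hq⟩
        obtain ⟨q, rfl⟩ := Submodule.Quotient.mk_surjective _ q
        rw [← hq]
        exact (Submodule.Quotient.mk_eq_zero _).2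
          (Ideal.mul_mem_right _ _ (X_mem_initialVarsIdeal_succ ⟨i, hi⟩))

theorem extVanishing_maximalIdeal (K : Type u) [Field K] (n : ℕ) :
    ExtVanishing (IsLocalRing.maximalIdeal (MvPowerSeries (Fin n) K)) (MvPowerSeries (Fin n) K)
      n := by
  have hbot : initialVarsIdeal K n 0 = ⊥ := by
    refine (Submodule.eq_bot_iff _).2 fun f hf => MvPowerSeries.ext fun m => ?_
    exact hf m fun j hj => absurd hj (Nat.not_lt_zero _)
  exact (extVanishing_quotient_initialVarsIdeal 0 n.zero_le).congr
    (Submodule.quotEquivOfEqBot _ hbot)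

end MvPowerSeries

end PowerSeries

section ExteriorContraction

open ExteriorAlgebra CliffordAlgebra Module

variable {R : Type u} [CommRing R] {M : Type u} [AddCommGroup M] [Module R M]

namespace ExteriorAlgebra

/-- The action of the exterior algebra of the dual module by iterated contraction. -/
noncomputable def contractHom (R M : Type u) [CommRing R] [AddCommGroup M] [Module R M] :
    ExteriorAlgebra R (Dual R M) →ₐ[R] End R (ExteriorAlgebra R M) :=
  ExteriorAlgebra.lift R ⟨contractLeft, fun α => LinearMap.ext fun x =>
    contractLeft_contractLeft (Q := 0) (d := α) x⟩

theorem contractHom_ι (α : Dual R M) :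
    contractHom R M (ExteriorAlgebra.ι R α) = contractLeft (Q := 0) α :=
  ExteriorAlgebra.lift_ι_apply _ _ _ _

theorem contractHom_ιMulti {m : ℕ} (α : Fin m → Dual R M) :
    contractHom R M (ιMulti R m α) =
      (List.ofFn fun i => (contractLeft (Q := 0) (α i) : End R (ExteriorAlgebra R M))).prod := by
  rw [ιMulti_apply, map_list_prod, List.map_ofFn]
  simp only [Function.comp_def, contractHom_ι]

theorem contractLeft_ι_mul_eq (α : Dual R M) (v : M) (x : ExteriorAlgebra R M) :
    contractLeft (Q := 0) α (ExteriorAlgebra.ι R v * x) =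
      α v • x - ExteriorAlgebra.ι R v * contractLeft (Q := 0) α x :=
  contractLeft_ι_mul (Q := 0) α v x

theorem contractLeft_mem_exteriorPower (α : Dual R M) {p : ℕ} {x : ExteriorAlgebra R M}
    (hx : x ∈ ⋀[R]^(p + 1) M) : contractLeft (Q := 0) α x ∈ ⋀[R]^p M := by
  induction p generalizing x with
  | zero =>
    rw [zero_add, exteriorPower, pow_one] at hx
    obtain ⟨v, rfl⟩ := hx
    rw [exteriorPower, pow_zero, Submodule.mem_one]
    exact ⟨α v, (contractLeft_ι (Q := 0) α v).symm⟩
  | succ p ih =>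
    rw [exteriorPower, pow_succ'] at hx
    induction hx using Submodule.mul_induction_on' with
    | mem_mul_mem a ha b hb =>
      obtain ⟨v, rfl⟩ := ha
      rw [contractLeft_ι_mul_eq]
      refine sub_mem (Submodule.smul_mem _ _ hb) ?_
      rw [exteriorPower, pow_succ']
      exact Submodule.mul_mem_mul ⟨v, rfl⟩ (ih hb)
    | add x _ y _ hx hy =>
      rw [map_add]
      exact add_mem hx hy

theorem contractLeft_ιMulti (α : Dual R M) {m : ℕ} (u : Fin (m + 1) → M) :
    contractLeft (Q := 0) α (ιMulti R (m + 1) u) =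
      ∑ s : Fin (m + 1), ((-1) ^ (s : ℕ) * α (u s)) • ιMulti R m fun i => u (s.succAbove i) := by
  induction m with
  | zero =>
    rw [ιMulti_succ_apply, contractLeft_ι_mul_eq]
    have h1 : contractLeft (Q := 0) α (1 : ExteriorAlgebra R M) = 0 := contractLeft_one ..
    simp [ιMulti_zero_apply, h1]
  | succ m ih =>
    rw [ιMulti_succ_apply, contractLeft_ι_mul_eq]
    rw [Fin.sum_univ_succ, ih, Finset.mul_sum, sub_eq_add_neg, ← Finset.sum_neg_distrib]
    congr 1
    · simp [Matrix.vecTail, Function.comp_def]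
    · refine Finset.sum_congr rfl fun s _ => ?_
      rw [mul_smul_comm, ← neg_smul, ιMulti_succ_apply]
      congr 1
      · simp [Matrix.vecTail, pow_succ]
      · congr 2
        funext i
        simp [Matrix.vecTail]

theorem exists_contractHom_ιMulti_apply_ιMulti (R M : Type u) [CommRing R] [AddCommGroup M]
    [Module R M] (m : ℕ) : ∃ c : Rˣ, ∀ (α : Fin m → Dual R M) (u : Fin m → M),
      contractHom R M (ιMulti R m α) (ιMulti R m u) =
        algebraMap R _ (c * (Matrix.of fun i j => α i (u j)).det) := by
  induction m with
  | zero => exact ⟨1, fun α u => by simp [ιMulti_zero_apply]⟩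
  | succ m ih =>
    obtain ⟨c, hc⟩ := ih
    refine ⟨c * (-1) ^ m, fun α u => ?_⟩
    rw [contractHom_ιMulti, List.ofFn_succ', List.concat_eq_append, List.prod_append,
      List.prod_singleton, Module.End.mul_apply, contractLeft_ιMulti, map_sum,
      Matrix.det_succ_row _ (Fin.last m), Finset.mul_sum, map_sum]
    refine Finset.sum_congr rfl fun s _ => ?_
    rw [map_smul, ← contractHom_ιMulti, hc, Algebra.smul_def, ← map_mul]
    congr 1
    simp only [Fin.val_last, Matrix.of_apply, Fin.succAbove_last, Units.val_mul,
      Units.val_pow_eq_pow_val, Units.val_neg, Units.val_one]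
    have hsq : (-1 : R) ^ m * (-1) ^ m = 1 := by rw [← mul_pow]; simp
    set d := (Matrix.of fun (i : Fin m) j => α i.castSucc (u (s.succAbove j))).det
    have hd : ((Matrix.of fun i j => α i (u j)).submatrix Fin.castSucc s.succAbove).det = d := rfl
    rw [pow_add, hd]
    linear_combination (-((-1) ^ (s : ℕ) * α (Fin.last m) (u s) * c * d)) * hsq

theorem contractHom_ιMulti_apply_mem_range_ι {k : ℕ} (α : Fin k → Dual R M)
    {x : ExteriorAlgebra R M} (hx : x ∈ ⋀[R]^(k + 1) M) :
    contractHom R M (ιMulti R k α) x ∈ LinearMap.range (ExteriorAlgebra.ι R (M := M)) := by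
  suffices h : ∀ (k p : ℕ) (α : Fin k → Dual R M) (x : ExteriorAlgebra R M), x ∈ ⋀[R]^(p + k) M →
      contractHom R M (ιMulti R k α) x ∈ ⋀[R]^p M by
    simpa only [exteriorPower, pow_one] using h k 1 α x (by rwa [add_comm])
  intro k
  induction k with
  | zero => exact fun p α x hx => by simpa [ιMulti_zero_apply] using hx
  | succ k ih =>
    intro p α x hx
    rw [ιMulti_succ_apply, map_mul, contractHom_ι, Module.End.mul_apply]
    refine contractLeft_mem_exteriorPower _ (ih _ _ _ ?_)
    rwa [add_right_comm, add_assoc]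

theorem contractHom_ιMulti_comp_eq_zero {k m : ℕ} (α : Fin k → Dual R M) {f : Fin m → Fin k}
    (hf : ¬ Function.Injective f) : contractHom R M (ιMulti R m (α ∘ f)) = 0 := by
  rw [ιMulti_eq_zero_of_not_inj fun h => hf h.of_comp, map_zero]

theorem contractHom_ιMulti_comp_apply_eq_zero {k : ℕ} (α : Fin k → Dual R M) (f : Fin k → Fin k)
    {x : ExteriorAlgebra R M} (hx : contractHom R M (ιMulti R k α) x = 0) :
    contractHom R M (ιMulti R k (α ∘ f)) x = 0 := by
  by_cases hf : Function.Injective f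
  · obtain ⟨σ, rfl⟩ : ∃ σ : Equiv.Perm (Fin k), σ = f :=
      ⟨Equiv.ofBijective f (Finite.injective_iff_bijective.1 hf), rfl⟩
    rw [AlternatingMap.map_perm, Units.smul_def, map_zsmul, LinearMap.smul_apply, hx, smul_zero]
  · rw [contractHom_ιMulti_comp_eq_zero α hf, LinearMap.zero_apply]

theorem contractHom_ιMulti_mul_contractLeft {k : ℕ} (α : Fin k → Dual R M) (i : Fin k) :
    contractHom R M (ιMulti R k α) * contractLeft (Q := 0) (α i) = 0 := by
  have h := contractHom_ιMulti_comp_eq_zero α (f := Fin.snoc (α := fun _ => Fin k) id i) <| by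
    intro h
    have := @h i.castSucc (Fin.last k) (by simp)
    exact (Fin.castSucc_lt_last i).ne this
  rw [contractHom_ιMulti, List.ofFn_succ', List.concat_eq_append, List.prod_append,
    List.prod_singleton] at h
  simpa [← contractHom_ιMulti] using h

/-- The contraction of a `k + 1`-vector by `k` linear forms. -/
noncomputable def contractToBase {k : ℕ} (α : Fin k → Dual R M) : ExteriorAlgebra R M →ₗ[R] M :=
  ιInv ∘ₗ contractHom R M (ιMulti R k α)

theorem contractHom_ιMulti_eq_zero_of_contractToBase {k : ℕ} {α : Fin k → Dual R M}
    {x : ExteriorAlgebra R M} (hx : x ∈ ⋀[R]^(k + 1) M) (h : contractToBase α x = 0) :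
    contractHom R M (ιMulti R k α) x = 0 := by
  obtain ⟨v, hv⟩ := contractHom_ιMulti_apply_mem_range_ι α hx
  rw [contractToBase, LinearMap.comp_apply, ← hv, ι_leftInverse] at h
  rw [← hv, h, map_zero]

theorem dual_contractToBase {k : ℕ} (β : Dual R M) (α : Fin k → Dual R M)
    {x : ExteriorAlgebra R M} (hx : x ∈ ⋀[R]^(k + 1) M) :
    algebraMap R (ExteriorAlgebra R M) (β (contractToBase α x)) =
      contractHom R M (ιMulti R (k + 1) (Fin.cons β α)) x := by
  obtain ⟨v, hv⟩ := contractHom_ιMulti_apply_mem_range_ι α hx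
  rw [contractToBase, LinearMap.comp_apply, ← hv, ι_leftInverse, ιMulti_succ_apply, map_mul,
    contractHom_ι, Module.End.mul_apply]
  change _ = contractLeft (Q := 0) β (contractHom R M (ιMulti R k α) x)
  rw [← hv]
  exact (contractLeft_ι (Q := 0) β v).symm

theorem apply_contractToBase {k : ℕ} (α : Fin k → Dual R M) (i : Fin k)
    {x : ExteriorAlgebra R M} (hx : x ∈ ⋀[R]^(k + 1) M) : α i (contractToBase α x) = 0 := by
  rw [← algebraMap_eq_zero_iff (M := M), dual_contractToBase _ _ hx]
  have h := contractHom_ιMulti_comp_eq_zero α (f := Fin.cons (α := fun _ => Fin k) i id) <| by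
    intro h
    have := @h i.succ 0 (by simp)
    exact Fin.succ_ne_zero i this
  have hcons : α ∘ Fin.cons (α := fun _ => Fin k) i id =
      Fin.cons (α := fun _ => Dual R M) (α i) α := by
    funext j
    refine Fin.cases ?_ (fun j => ?_) j <;> simp
  rw [← hcons, h, LinearMap.zero_apply]

/-- Contracting a decomposable `k + 1`-vector by `k` linear forms gives the Cramer vector. -/
theorem exists_contractToBase_ιMulti (R : Type u) [CommRing R] (n k : ℕ) :
    ∃ c : Rˣ, ∀ (α : Fin k → Dual R (Fin n → R)) (u : Fin (k + 1) → Fin n → R),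
      contractToBase α (ιMulti R (k + 1) u) = c • ∑ s : Fin (k + 1),
        ((-1) ^ (s : ℕ) * (Matrix.of fun i j => α i (u (s.succAbove j))).det) • u s := by
  obtain ⟨c, hc⟩ := exists_contractHom_ιMulti_apply_ιMulti R (Fin n → R) (k + 1)
  refine ⟨c, fun α u => funext fun j => ?_⟩
  have hu : ιMulti R (k + 1) u ∈ ⋀[R]^(k + 1) (Fin n → R) := ιMulti_range R (k + 1) ⟨u, rfl⟩
  refine algebraMap_leftInverse (R := R) (M := Fin n → R) |>.injective ?_
  refine (dual_contractToBase (LinearMap.proj j) α hu).trans ?_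
  rw [hc, Matrix.det_succ_row_zero, Pi.smul_apply, Finset.sum_apply, Units.smul_def, smul_eq_mul]
  congr 2
  refine Finset.sum_congr rfl fun s _ => ?_
  have hd : ((Matrix.of fun i l => (Fin.cons (LinearMap.proj j) α :
      Fin (k + 1) → Dual R (Fin n → R)) i (u l)).submatrix Fin.succ s.succAbove).det =
      (Matrix.of fun i l => α i (u (s.succAbove l))).det := rfl
  rw [hd]
  simp
  ring

end ExteriorAlgebra

end ExteriorContraction

section BuchsbaumRim

open ExteriorAlgebra CliffordAlgebra Module

variable {R : Type u} [CommRing R]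

section FallingProduct

variable {V : Type u} [AddCommGroup V] [Module R V]

/-- The product `(D - cδ) (D - (c + 1)δ) ⋯ (D - (c + m - 1)δ)`. -/
def Module.End.fallingProd (D : End R V) (δ : R) : ℕ → ℕ → End R V
  | 0, _ => 1
  | m + 1, c => (D - (c * δ) • (1 : End R V)) * fallingProd D δ m (c + 1)

namespace Module.End

theorem fallingProd_mul {D a : End R V} {δ : R} (h : a * D = D * a + δ • a) (m c : ℕ) :
    fallingProd D δ m c * a = a * fallingProd D δ m (c + 1) := by
  induction m generalizing c with
  | zero => simp [fallingProd]
  | succ m ih =>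
    rw [fallingProd, fallingProd, mul_assoc, ih, ← mul_assoc, ← mul_assoc, sub_mul, mul_sub, h]
    congr 1
    simp only [smul_mul_assoc, one_mul, mul_smul_comm, mul_one, Nat.cast_succ, add_mul, add_smul,
      mul_add]
    abel

theorem fallingProd_apply_eq_zero {k : ℕ} {a b : Fin k → End R V} {δ : R}
    (h : ∀ i, a i * ∑ l, b l * a l = (∑ l, b l * a l) * a i + δ • a i) (m : ℕ) {x : V}
    (hx : ∀ f : Fin m → Fin k, (List.ofFn fun i => a (f i)).prod x = 0) :
    fallingProd (∑ l, b l * a l) δ m 0 x = 0 := by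
  induction m generalizing x with
  | zero => simpa [fallingProd] using hx Fin.elim0
  | succ m ih =>
    rw [fallingProd, Nat.cast_zero, zero_mul, zero_smul, sub_zero, Finset.sum_mul,
      LinearMap.sum_apply]
    refine Finset.sum_eq_zero fun i _ => ?_
    rw [mul_assoc, ← fallingProd_mul (h i), mul_apply, mul_apply, ih, map_zero]
    intro f
    have := hx (Fin.snoc (α := fun _ => Fin k) f i)
    rw [List.ofFn_succ', List.concat_eq_append, List.prod_append, List.prod_singleton] at this
    simpa using this

end Module.End

end FallingProduct

variable {M : Type u} [AddCommGroup M] [Module R M] {k : ℕ}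

namespace BuchsbaumRim

/-- The term of the Buchsbaum–Rim complex in exterior degree `p`: the exterior power `⋀ᵖ M`
tensored with the divided power of degree `p - k - 1` of the free module of rank `k`. -/
def chain (R M : Type u) [CommRing R] [AddCommGroup M] [Module R M] (k p : ℕ) :
    Submodule R ((Fin k → ℕ) → ExteriorAlgebra R M) where
  carrier := {x | ∀ m, x m ∈ ⋀[R]^p M ∧ (∑ i, m i + k + 1 ≠ p → x m = 0)}
  zero_mem' := fun _ => ⟨zero_mem _, fun _ => rfl⟩
  add_mem' := fun hx hy m => ⟨add_mem (hx m).1 (hy m).1, fun h => by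
    rw [Pi.add_apply, (hx m).2 h, (hy m).2 h, add_zero]⟩
  smul_mem' := fun c x hx m => ⟨Submodule.smul_mem _ c (hx m).1, fun h => by
    rw [Pi.smul_apply, (hx m).2 h, smul_zero]⟩

/-- The differential of the Buchsbaum–Rim complex. -/
def diff (α : Fin k → Dual R M) :
    End R ((Fin k → ℕ) → ExteriorAlgebra R M) where
  toFun x m := ∑ i, contractLeft (Q := 0) (α i) (x (m + Pi.single i 1))
  map_add' x y := by
    funext m
    simp [Finset.sum_add_distrib]
  map_smul' c x := by
    funext m
    simp [Finset.smul_sum]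

/-- Multiplication by vectors `w i`, a contracting homotopy up to torsion when the `w i` are dual
to the linear forms defining the differential. -/
def homotopy (w : Fin k → M) :
    End R ((Fin k → ℕ) → ExteriorAlgebra R M) where
  toFun x m := ∑ l, (m l : R) • (ExteriorAlgebra.ι R (w l) * x (m - Pi.single l 1))
  map_add' x y := by
    funext m
    simp [Finset.sum_add_distrib, mul_add]
  map_smul' c x := by
    funext m
    simp [Finset.smul_sum, smul_comm c]

/-- The number operator `∑ i, w i ∧ (α i ⌋ ·)`. -/
noncomputable def number (α : Fin k → Dual R M) (w : Fin k → M) : End R (ExteriorAlgebra R M) :=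
  ∑ l, LinearMap.mulLeft R (ExteriorAlgebra.ι R (w l)) *
    (contractLeft (Q := 0) (α l) : End R (ExteriorAlgebra R M))

theorem diff_apply (α : Fin k → Dual R M) (x : (Fin k → ℕ) → ExteriorAlgebra R M) (m : Fin k → ℕ) :
    diff α x m = ∑ i, contractLeft (Q := 0) (α i) (x (m + Pi.single i 1)) := rfl

theorem homotopy_apply (w : Fin k → M) (x : (Fin k → ℕ) → ExteriorAlgebra R M) (m : Fin k → ℕ) :
    homotopy w x m = ∑ l, (m l : R) • (ExteriorAlgebra.ι R (w l) * x (m - Pi.single l 1)) := rfl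

theorem number_apply (α : Fin k → Dual R M) (w : Fin k → M) (x : ExteriorAlgebra R M) :
    number α w x = ∑ l, ExteriorAlgebra.ι R (w l) * contractLeft (Q := 0) (α l) x := by
  simp [number]

theorem sum_add_single (m : Fin k → ℕ) (i : Fin k) :
    ∑ j, (m + Pi.single i 1 : Fin k → ℕ) j = ∑ j, m j + 1 := by
  simp [Finset.sum_add_distrib]

theorem single_le {m : Fin k → ℕ} {l : Fin k} (hl : 0 < m l) : Pi.single l 1 ≤ m := fun j => by
  rcases eq_or_ne j l with rfl | hj
  · rw [Pi.single_eq_same]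
    exact hl
  · simp [hj]

theorem diff_mem_chain (α : Fin k → Dual R M) {p : ℕ} {x : (Fin k → ℕ) → ExteriorAlgebra R M}
    (hx : x ∈ chain R M k (p + 1)) : diff α x ∈ chain R M k p := by
  intro m
  rw [diff_apply]
  refine ⟨sum_mem fun i _ => contractLeft_mem_exteriorPower _ (hx _).1, fun hm => ?_⟩
  refine Finset.sum_eq_zero fun i _ => ?_
  rw [(hx _).2, map_zero]
  rw [sum_add_single]
  lia

theorem homotopy_mem_chain (w : Fin k → M) {p : ℕ} {x : (Fin k → ℕ) → ExteriorAlgebra R M}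
    (hx : x ∈ chain R M k p) : homotopy w x ∈ chain R M k (p + 1) := by
  intro m
  rw [homotopy_apply]
  refine ⟨sum_mem fun l _ => Submodule.smul_mem _ _ ?_, fun hm => ?_⟩
  · rw [exteriorPower, pow_succ']
    exact Submodule.mul_mem_mul ⟨_, rfl⟩ (hx _).1
  · refine Finset.sum_eq_zero fun l _ => ?_
    rcases Nat.eq_zero_or_pos (m l) with hl | hl
    · rw [hl, Nat.cast_zero, zero_smul]
    · rw [(hx _).2, mul_zero, smul_zero]
      have h := sum_add_single (m - Pi.single l 1) l
      rw [tsub_add_cancel_of_le (single_le hl)] at h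
      lia

theorem number_mem_chain (α : Fin k → Dual R M) (w : Fin k → M) {p : ℕ}
    {x : (Fin k → ℕ) → ExteriorAlgebra R M} (hx : x ∈ chain R M k (p + 1)) :
    (number α w).compLeft (Fin k → ℕ) x ∈ chain R M k (p + 1) := by
  intro m
  refine ⟨?_, fun hm => ?_⟩
  · rw [LinearMap.compLeft_apply, Function.comp_apply, number_apply]
    refine sum_mem fun l _ => ?_
    rw [exteriorPower, pow_succ']
    exact Submodule.mul_mem_mul ⟨_, rfl⟩ (contractLeft_mem_exteriorPower _ (hx _).1)
  · rw [LinearMap.compLeft_apply, Function.comp_apply, (hx m).2 hm, map_zero]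

theorem diff_diff (α : Fin k → Dual R M) (x : (Fin k → ℕ) → ExteriorAlgebra R M) :
    diff α (diff α x) = 0 := by
  funext m
  simp only [diff_apply, map_sum, Pi.zero_apply]
  rw [← Finset.sum_product']
  refine Finset.sum_involution (fun p _ => p.swap) (fun p _ => ?_) (fun p _ hp he => hp ?_)
    (fun _ _ => Finset.mem_univ _) (fun p _ => Prod.swap_swap p)
  · rw [Prod.fst_swap, Prod.snd_swap, add_right_comm]
    exact add_eq_zero_iff_eq_neg.2 (contractLeft_comm ..)
  · rw [show p.1 = p.2 from congrArg Prod.snd he]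
    exact contractLeft_contractLeft ..

variable {α : Fin k → Dual R M} {w : Fin k → M} {δ : R}

theorem contractLeft_number (h : ∀ i l, α i (w l) = if i = l then δ else 0) (i : Fin k)
    (x : ExteriorAlgebra R M) :
    contractLeft (Q := 0) (α i) (number α w x) =
      number α w (contractLeft (Q := 0) (α i) x) + δ • contractLeft (Q := 0) (α i) x := by
  have hc (l) : contractLeft (Q := 0) (α i) (contractLeft (Q := 0) (α l) x) =
      - contractLeft (Q := 0) (α l) (contractLeft (Q := 0) (α i) x) := contractLeft_comm ..
  simp only [number_apply, map_sum, contractLeft_ι_mul_eq, h, Finset.sum_sub_distrib, ite_smul,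
    zero_smul, Finset.sum_ite_eq, Finset.mem_univ, if_true, hc, mul_neg, Finset.sum_neg_distrib]
  abel

theorem diff_number (h : ∀ i l, α i (w l) = if i = l then δ else 0)
    (x : (Fin k → ℕ) → ExteriorAlgebra R M) :
    diff α ((number α w).compLeft _ x) =
      (number α w).compLeft _ (diff α x) + δ • diff α x := by
  funext m
  simp only [diff_apply, LinearMap.compLeft_apply, Function.comp_apply, contractLeft_number h,
    Pi.add_apply, Pi.smul_apply, map_sum, Finset.sum_add_distrib, Finset.smul_sum]

theorem diff_homotopy (h : ∀ i l, α i (w l) = if i = l then δ else 0)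
    (x : (Fin k → ℕ) → ExteriorAlgebra R M) (m : Fin k → ℕ) :
    diff α (homotopy w x) m + homotopy w (diff α x) m =
      ((∑ i, m i + k : ℕ) * δ) • x m - number α w (x m) := by
  simp only [diff_apply, homotopy_apply, map_sum, map_smul, contractLeft_ι_mul_eq, h, smul_sub,
    Finset.sum_sub_distrib]
  have h1 : ∑ i, ∑ l, ((m + Pi.single i 1 : Fin k → ℕ) l : R) • (if i = l then δ else 0) •
      x (m + Pi.single i 1 - Pi.single l 1) = ((∑ i, m i + k : ℕ) * δ) • x m := by
    simp [add_mul, smul_smul, ← Finset.sum_smul, Finset.sum_add_distrib,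
      Finset.sum_mul]
  have h2 : ∑ i, ∑ l, ((m + Pi.single i 1 : Fin k → ℕ) l : R) •
      (ExteriorAlgebra.ι R (w l) * contractLeft (Q := 0) (α i) (x (m + Pi.single i 1 - Pi.single l 1)))
      = number α w (x m) + ∑ l, (m l : R) • (ExteriorAlgebra.ι R (w l) * ∑ i,
        contractLeft (Q := 0) (α i) (x (m - Pi.single l 1 + Pi.single i 1))) := by
    simp only [Pi.add_apply, Nat.cast_add, add_smul, Finset.sum_add_distrib, Finset.mul_sum,
      Finset.smul_sum]
    rw [add_comm, Finset.sum_comm (f := fun i l => (m l : R) • _)]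
    congr 1
    · rw [number_apply]
      refine Finset.sum_congr rfl fun i _ => ?_
      rw [Finset.sum_eq_single i (fun l _ hl => by simp [hl]) (by simp)]
      simp
    · refine Finset.sum_congr rfl fun l _ => Finset.sum_congr rfl fun i _ => ?_
      rcases Nat.eq_zero_or_pos (m l) with hl | hl
      · simp [hl]
      · rw [tsub_add_eq_add_tsub (single_le hl)]
  rw [h1, h2]
  abel

theorem exists_fallingProd_eq (h : ∀ i l, α i (w l) = if i = l then δ else 0) {j : ℕ}
    {x : (Fin k → ℕ) → ExteriorAlgebra R M} (hx : x ∈ chain R M k (j + k + 1))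
    (hdx : diff α x = 0) (m c : ℕ) (hmc : c + m ≤ j + k) :
    ∃ N : ℕ, N ≠ 0 ∧ ∃ y ∈ chain R M k (j + k + 2),
      End.fallingProd ((number α w).compLeft _) δ m c x = (N * δ ^ m) • x + diff α y := by
  have hD : (number α w).compLeft _ x = ((j + k : ℕ) * δ) • x - diff α (homotopy w x) := by
    funext m
    have := diff_homotopy h x m
    rw [hdx, map_zero, Pi.zero_apply, add_zero] at this
    rw [Pi.sub_apply, this, LinearMap.compLeft_apply, Function.comp_apply, Pi.smul_apply]
    by_cases hm : ∑ i, m i + k + 1 = j + k + 1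
    · rw [show ∑ i, m i + k = j + k by lia, sub_sub_cancel]
    · rw [(hx m).2 hm]
      simp
  induction m generalizing c with
  | zero => exact ⟨1, one_ne_zero, 0, zero_mem _, by simp [End.fallingProd]⟩
  | succ m ih =>
    obtain ⟨N, hN, y, hy, hQ⟩ := ih (c + 1) (by lia)
    refine ⟨N * (j + k - c), mul_ne_zero hN (by lia),
      - (N * δ ^ m) • homotopy w x + (number α w).compLeft _ y - ((c + 1) * δ) • y, ?_, ?_⟩
    · refine sub_mem (add_mem (Submodule.smul_mem _ _ (homotopy_mem_chain w hx)) ?_)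
        (Submodule.smul_mem _ _ hy)
      exact number_mem_chain α w hy
    · rw [End.fallingProd, End.mul_apply, hQ, LinearMap.sub_apply, map_add, map_smul, hD,
        map_sub, map_add, map_smul, map_smul, Nat.cast_mul, Nat.cast_sub (by lia)]
      simp only [LinearMap.smul_apply, End.one_apply, map_add, map_smul, diff_number h]
      push_cast
      module

theorem fallingProd_compLeft_apply (D : End R (ExteriorAlgebra R M)) (m c : ℕ)
    (x : (Fin k → ℕ) → ExteriorAlgebra R M) (i : Fin k → ℕ) :
    End.fallingProd (D.compLeft _) δ m c x i = End.fallingProd D δ m c (x i) := by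
  induction m generalizing c x with
  | zero => simp [End.fallingProd]
  | succ m ih => simp [End.fallingProd, ih]

/-- If `x` is a cycle killed by all `m`-fold contractions, then `δ ^ m • x` is a boundary. -/
theorem pow_smul_mem_map_diff (hN : ∀ N : ℕ, N ≠ 0 → IsUnit (N : R))
    (h : ∀ i l, α i (w l) = if i = l then δ else 0) {j : ℕ}
    {x : (Fin k → ℕ) → ExteriorAlgebra R M} (hx : x ∈ chain R M k (j + k + 1))
    (hdx : diff α x = 0) (m : ℕ) (hm : m ≤ j + k)
    (hxm : ∀ i, ∀ f : Fin m → Fin k, contractHom R M (ιMulti R m (α ∘ f)) (x i) = 0) :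
    δ ^ m • x ∈ (chain R M k (j + k + 2)).map (diff α) := by
  obtain ⟨N, hN0, y, hy, hQ⟩ := exists_fallingProd_eq h hx hdx m 0 (by lia)
  have hQ0 : End.fallingProd ((number α w).compLeft _) δ m 0 x = 0 := by
    funext i
    rw [fallingProd_compLeft_apply]
    refine End.fallingProd_apply_eq_zero (fun i => LinearMap.ext fun x => contractLeft_number h i x)
      m fun f => ?_
    have := hxm i f
    rwa [contractHom_ιMulti] at this
  obtain ⟨u, hu⟩ := hN N hN0
  have hmem : (N : R) • (δ ^ m • x) ∈ (chain R M k (j + k + 2)).map (diff α) :=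
    ⟨-y, neg_mem hy, by
      rw [map_neg, smul_smul, neg_eq_iff_add_eq_zero, add_comm, ← hQ, hQ0]⟩
  have hinv := Submodule.smul_mem _ (↑u⁻¹ : R) hmem
  rwa [smul_smul, ← hu, Units.inv_mul, one_smul] at hinv

/-- In positive symmetric degree, the homology is killed by `δ ^ (k + 1)`. -/
theorem pow_smul_mem_map_diff_of_diff_eq_zero (hN : ∀ N : ℕ, N ≠ 0 → IsUnit (N : R))
    (h : ∀ i l, α i (w l) = if i = l then δ else 0) {p : ℕ} (hp : k + 2 ≤ p)
    {x : (Fin k → ℕ) → ExteriorAlgebra R M} (hx : x ∈ chain R M k p) (hdx : diff α x = 0) :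
    δ ^ (k + 1) • x ∈ (chain R M k (p + 1)).map (diff α) := by
  obtain ⟨j, rfl⟩ := Nat.exists_eq_add_of_le hp
  rw [show k + 2 + j = (j + 1) + k + 1 by lia] at hx
  rw [show k + 2 + j + 1 = (j + 1) + k + 2 by lia]
  refine pow_smul_mem_map_diff hN h hx hdx _ (by lia) fun i f => ?_
  rw [contractHom_ιMulti_comp_eq_zero, LinearMap.zero_apply]
  intro hf
  simpa using Fintype.card_le_of_injective f hf

/-- In symmetric degree zero, the homology is killed by `δ ^ (k + 1)`. -/
theorem pow_smul_mem_map_diff_of_contractToBase_eq_zero (hN : ∀ N : ℕ, N ≠ 0 → IsUnit (N : R))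
    (h : ∀ i l, α i (w l) = if i = l then δ else 0)
    {x : (Fin k → ℕ) → ExteriorAlgebra R M} (hx : x ∈ chain R M k (k + 1))
    (hdx : contractToBase α (x 0) = 0) :
    δ ^ (k + 1) • x ∈ (chain R M k (k + 2)).map (diff α) := by
  have hx0 (m) (hm : m ≠ 0) : x m = 0 := (hx m).2 fun h => hm <| by
    have : ∑ i, m i = 0 := by lia
    simpa [Finset.sum_eq_zero_iff, funext_iff] using this
  have hx' : x ∈ chain R M k (0 + k + 1) := by rwa [zero_add]
  have := pow_smul_mem_map_diff hN h hx' ?_ k (by lia) fun i f => ?_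
  · rw [pow_succ', mul_smul]
    rw [zero_add] at this
    exact Submodule.smul_mem _ _ this
  · funext m
    rw [diff_apply]
    refine Finset.sum_eq_zero fun i _ => ?_
    rw [hx0, map_zero]
    intro h0
    simpa using congrFun h0 i
  · rcases eq_or_ne i 0 with rfl | hi
    · exact contractHom_ιMulti_comp_apply_eq_zero α f
        (contractHom_ιMulti_eq_zero_of_contractToBase (hx 0).1 hdx)
    · rw [hx0 i hi, map_zero]

theorem contractToBase_diff (α : Fin k → Dual R M) (x : (Fin k → ℕ) → ExteriorAlgebra R M) :
    contractToBase α (diff α x 0) = 0 := by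
  rw [diff_apply, map_sum]
  refine Finset.sum_eq_zero fun i _ => ?_
  have := LinearMap.congr_fun (contractHom_ιMulti_mul_contractLeft α i) (x (0 + Pi.single i 1))
  rw [End.mul_apply] at this
  rw [contractToBase, LinearMap.comp_apply, this, LinearMap.zero_apply, map_zero]

theorem finite_setOf_sum_add_eq (k p : ℕ) : Finite {m : Fin k → ℕ // ∑ i, m i + k + 1 = p} := by
  refine Set.Finite.subset (Set.finite_Iic fun _ => p) fun m (hm : _ = _) i => ?_
  have := Finset.single_le_sum (f := m) (fun _ _ => Nat.zero_le _) (Finset.mem_univ i)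
  lia

/-- The Buchsbaum–Rim chains as a finite power of an exterior power. -/
noncomputable def chainEquiv (R M : Type u) [CommRing R] [AddCommGroup M] [Module R M] (k p : ℕ) :
    chain R M k p ≃ₗ[R] ({m : Fin k → ℕ // ∑ i, m i + k + 1 = p} → ⋀[R]^p M) where
  toFun x m := ⟨x.1 m, (x.2 m).1⟩
  map_add' _ _ := rfl
  map_smul' _ _ := rfl
  invFun y := ⟨fun m => if h : ∑ i, m i + k + 1 = p then y ⟨m, h⟩ else 0, fun m => by
    dsimp only
    split_ifs with h
    · exact ⟨(y ⟨m, h⟩).2, fun h' => absurd h h'⟩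
    · exact ⟨zero_mem _, fun _ => rfl⟩⟩
  left_inv x := by
    ext m
    by_cases h : ∑ i, m i + k + 1 = p
    · simp [h]
    · simp [h, (x.2 m).2 h]
  right_inv y := by
    funext m
    simp [m.2]

instance (k p : ℕ) [Module.Free R M] : Module.Free R (chain R M k p) :=
  have := finite_setOf_sum_add_eq k p
  .of_equiv (chainEquiv R M k p).symm

instance (k p : ℕ) [Module.Finite R M] : Module.Finite R (chain R M k p) :=
  have := finite_setOf_sum_add_eq k p
  .equiv (chainEquiv R M k p).symm

end BuchsbaumRim

end BuchsbaumRim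

section Acyclicity

variable {R : Type u} [CommRing R] {X Y : Type u} [AddCommGroup X] [Module R X] [AddCommGroup Y]
  [Module R Y]

/-- The inductive step of the acyclicity lemma: if the homology of `B ≤ C → Y` is killed by `I`,
then the grade of the image of `C` is controlled by that of `C` and `B`. -/
theorem ExtVanishing.map_of_smul_mem {I : Ideal R} {C B : Submodule R X} (f : X →ₗ[R] Y) {t : ℕ}
    (ht : 1 ≤ t) (hC : ExtVanishing I C t) (hB : ExtVanishing I B (t + 1)) (hBC : B ≤ C)
    (hBf : ∀ b ∈ B, f b = 0) (hI : ∀ r ∈ I, ∀ z ∈ C, f z = 0 → r • z ∈ B) :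
    ExtVanishing I (C.map f) t := by
  have hB' : ExtVanishing I (B.submoduleOf C) (t + 1) :=
    hB.congr (Submodule.submoduleOfEquivOfLe hBC).symm
  have hker : B.submoduleOf C = LinearMap.ker (f.submoduleMap C) := by
    refine eq_of_smul_le (fun b hb => Subtype.ext (hBf _ hb)) (hC.mono ht) (hB'.mono (by lia)) ?_
    exact fun r hr z hz => hI r hr z z.2 (congrArg Subtype.val hz)
  refine right (f := (B.submoduleOf C).subtype) (g := f.submoduleMap C)
    (Submodule.injective_subtype _) ?_ (LinearMap.submoduleMap_surjective _ _) hB' hC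
  rw [LinearMap.exact_iff, Submodule.range_subtype, hker]

end Acyclicity

section Cramer

open ExteriorAlgebra BuchsbaumRim Module

variable {R : Type u} [CommRing R] {n k : ℕ}

namespace Matrix

/-- The linear forms given by the rows of a matrix. -/
def rowForm (A : Matrix (Fin k) (Fin n) R) (i : Fin k) : Dual R (Fin n → R) :=
  LinearMap.proj i ∘ₗ A.mulVecLin

/-- The Cramer vector attached to `k + 1` columns of a `k × n` matrix. -/
def cramerVector (A : Matrix (Fin k) (Fin n) R) (e : Fin (k + 1) ↪o Fin n) : Fin n → R :=
  ∑ s : Fin (k + 1), ((-1 : R) ^ (s : ℕ) * (A.submatrix id fun i => e (s.succAbove i)).det) •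
    (Pi.single (e s) 1 : Fin n → R)

/-- The ideal generated by the `(k + 1)`-st powers of the maximal minors of a `k × n` matrix. -/
def minorPowIdeal (A : Matrix (Fin k) (Fin n) R) : Ideal R :=
  Ideal.span (Set.range fun e : Fin k ↪o Fin n => (A.submatrix id e).det ^ (k + 1))

theorem exists_rowForm_eq (A : Matrix (Fin k) (Fin n) R) (e : Fin k ↪o Fin n) :
    ∃ w : Fin k → Fin n → R, ∀ i l, A.rowForm i (w l) =
      if i = l then (A.submatrix id e).det else 0 := by
  refine ⟨fun l => ∑ j, (A.submatrix id e).adjugate j l • Pi.single (e j) 1, fun i l => ?_⟩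
  have h := congrFun (congrFun (A.submatrix id e).mul_adjugate i) l
  rw [mul_apply, smul_apply, one_apply, smul_eq_mul, mul_ite, mul_one, mul_zero] at h
  rw [← h, map_sum]
  refine Finset.sum_congr rfl fun j _ => ?_
  rw [map_smul, smul_eq_mul, mul_comm]
  simp [rowForm]

theorem smul_mem_of_mem_minorPowIdeal {V : Type u} [AddCommGroup V] [Module R V]
    {A : Matrix (Fin k) (Fin n) R} {B : Submodule R V} {z : V}
    (h : ∀ e : Fin k ↪o Fin n, (A.submatrix id e).det ^ (k + 1) • z ∈ B) {r : R}
    (hr : r ∈ A.minorPowIdeal) : r • z ∈ B := by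
  suffices A.minorPowIdeal ≤ B.comap (LinearMap.toSpanSingleton R V z) from this hr
  refine Ideal.span_le.2 ?_
  rintro _ ⟨e, rfl⟩
  exact h e

theorem extVanishing_map_diff [Nontrivial R] (A : Matrix (Fin k) (Fin n) R)
    (hN : ∀ N : ℕ, N ≠ 0 → IsUnit (N : R)) (hV : ExtVanishing A.minorPowIdeal R (n - k + 1))
    {p : ℕ} (hp : k + 1 ≤ p) (hpn : p ≤ n) :
    ExtVanishing A.minorPowIdeal ((chain R (Fin n → R) k (p + 1)).map (diff A.rowForm))
      (p - k + 2) := by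
  induction hpn using Nat.decreasingInduction with
  | self =>
    have hbot : chain R (Fin n → R) k (n + 1) = ⊥ := by
      refine (Submodule.eq_bot_iff _).2 fun x hx => funext fun m => ?_
      have hm := (hx m).1
      rw [← exteriorPower.ιMulti_family_span_fixedDegree_of_span R
        (Pi.basisFun R (Fin n)).span_eq] at hm
      have : IsEmpty (Set.powersetCard (Fin n) (n + 1)) := by
        refine ⟨fun s => ?_⟩
        have := Fintype.card_le_of_injective _ (Set.powersetCard.ofFinEmbEquiv.symm s).injective
        simp at this
      rwa [Set.range_eq_empty, Submodule.span_empty, Submodule.mem_bot] at hm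
    rw [hbot, Submodule.map_bot]
    exact .of_subsingleton
  | of_succ p hpn ih =>
    have hB := ih (by lia)
    rw [show p + 1 - k + 2 = p - k + 2 + 1 by lia] at hB
    refine .map_of_smul_mem _ (by lia) (.of_free (hV.mono (by lia))) hB ?_ ?_ fun r hr z hz hdz => ?_
    · rintro _ ⟨x, hx, rfl⟩
      exact diff_mem_chain _ hx
    · rintro _ ⟨x, hx, rfl⟩
      exact diff_diff _ _
    · refine smul_mem_of_mem_minorPowIdeal (fun e => ?_) hr
      obtain ⟨w, hw⟩ := A.exists_rowForm_eq e
      exact pow_smul_mem_map_diff_of_diff_eq_zero hN hw (by lia) hz hdz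

theorem extVanishing_map_contractToBase [Nontrivial R] (A : Matrix (Fin k) (Fin n) R)
    (hkn : k < n) (hN : ∀ N : ℕ, N ≠ 0 → IsUnit (N : R))
    (hV : ExtVanishing A.minorPowIdeal R (n - k + 1)) :
    ExtVanishing A.minorPowIdeal ((⋀[R]^(k + 1) (Fin n → R)).map (contractToBase A.rowForm)) 2 := by
  have hB := A.extVanishing_map_diff hN hV le_rfl hkn
  rw [show k + 1 - k + 2 = 2 + 1 by lia] at hB
  have h := ExtVanishing.map_of_smul_mem (C := chain R (Fin n → R) k (k + 1))
    (contractToBase A.rowForm ∘ₗ LinearMap.proj 0) one_le_two (.of_free (hV.mono (by lia))) hB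
    ?_ ?_ fun r hr z hz hdz => ?_
  · have hproj : ⋀[R]^(k + 1) (Fin n → R) =
        (chain R (Fin n → R) k (k + 1)).map (LinearMap.proj 0) := by
      apply le_antisymm
      · refine fun y hy => ⟨Pi.single 0 y, fun m => ?_, by simp⟩
        rcases eq_or_ne m 0 with rfl | hm
        · simpa using hy
        · simp [hm]
      · rintro _ ⟨x, hx, rfl⟩
        exact (hx 0).1
    rwa [hproj, ← Submodule.map_comp]
  · rintro _ ⟨x, hx, rfl⟩
    exact diff_mem_chain _ hx
  · rintro _ ⟨x, hx, rfl⟩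
    exact contractToBase_diff _ _
  · refine smul_mem_of_mem_minorPowIdeal (fun e => ?_) hr
    obtain ⟨w, hw⟩ := A.exists_rowForm_eq e
    exact pow_smul_mem_map_diff_of_contractToBase_eq_zero hN hw hz hdz

theorem rowForm_submatrix (A : Matrix (Fin k) (Fin n) R) (e : Fin k → Fin n) :
    (of fun i j => A.rowForm i (Pi.single (e j) 1)) = A.submatrix id e := by
  ext i j
  simp [rowForm]

theorem map_contractToBase_eq_span (A : Matrix (Fin k) (Fin n) R) :
    (⋀[R]^(k + 1) (Fin n → R)).map (contractToBase A.rowForm) =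
      Submodule.span R (Set.range A.cramerVector) := by
  obtain ⟨c, hc⟩ := exists_contractToBase_ιMulti R n k
  have hbasis (e : Fin (k + 1) ↪o Fin n) : contractToBase A.rowForm
      (ExteriorAlgebra.ιMulti R (k + 1) (Pi.basisFun R (Fin n) ∘ e)) = c • A.cramerVector e := by
    rw [hc]
    simp only [Function.comp_apply, Pi.basisFun_apply, cramerVector]
    simp only [rowForm_submatrix A fun j => e _]
  rw [← exteriorPower.ιMulti_family_span_fixedDegree_of_span R (Pi.basisFun R (Fin n)).span_eq,
    Submodule.map_span, ← Set.range_comp]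
  refine le_antisymm (Submodule.span_le.2 ?_) (Submodule.span_le.2 ?_)
  · rintro _ ⟨s, rfl⟩
    refine Set.mem_of_eq_of_mem (hbasis (Set.powersetCard.ofFinEmbEquiv.symm s)) ?_
    exact Submodule.smul_mem _ (c : R) (Submodule.subset_span ⟨_, rfl⟩)
  · rintro _ ⟨e, rfl⟩
    rw [← inv_smul_smul c (A.cramerVector e), ← hbasis]
    refine Submodule.smul_mem _ (↑c⁻¹ : R)
      (Submodule.subset_span ⟨Set.powersetCard.ofFinEmbEquiv e, ?_⟩)
    simp [ExteriorAlgebra.ιMulti_family]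

theorem det_smul_mem_map_contractToBase (A : Matrix (Fin k) (Fin n) R) (e : Fin k ↪o Fin n)
    {v : Fin n → R} (hv : A *ᵥ v = 0) :
    (A.submatrix id e).det • v ∈ (⋀[R]^(k + 1) (Fin n → R)).map (contractToBase A.rowForm) := by
  obtain ⟨c, hc⟩ := exists_contractToBase_ιMulti R n k
  refine ⟨(↑c⁻¹ : R) • ExteriorAlgebra.ιMulti R (k + 1) (Fin.cons v fun j => Pi.single (e j) 1),
    Submodule.smul_mem _ _ (ιMulti_range R (k + 1) ⟨_, rfl⟩), ?_⟩
  rw [map_smul, hc, ← Units.smul_def, inv_smul_smul, Fin.sum_univ_succ, Finset.sum_eq_zero,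
    add_zero]
  · simp [rowForm_submatrix]
  · intro s _
    rw [det_eq_zero_of_column_eq_zero ⟨0, s.pos⟩, mul_zero, zero_smul]
    intro i
    have h0 : s.succ.succAbove ⟨0, s.pos⟩ = 0 :=
      Fin.succAbove_of_castSucc_lt _ _ (Fin.succ_pos s)
    rw [of_apply, h0, Fin.cons_zero]
    exact congrFun hv i

/-- If the ideal generated by the powers of the maximal minors of a `k × n` matrix has grade at
least `n - k + 1`, then the kernel of the matrix is generated by its Cramer vectors. -/
theorem ker_mulVecLin_eq_span_cramerVector [Nontrivial R] (A : Matrix (Fin k) (Fin n) R)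
    (hkn : k < n) (hN : ∀ N : ℕ, N ≠ 0 → IsUnit (N : R))
    (hV : ExtVanishing A.minorPowIdeal R (n - k + 1)) :
    LinearMap.ker A.mulVecLin = Submodule.span R (Set.range A.cramerVector) := by
  rw [← map_contractToBase_eq_span]
  symm
  refine ExtVanishing.eq_of_smul_le ?_ (.of_free (hV.mono (by lia)))
    (A.extVanishing_map_contractToBase hkn hN hV) fun r hr z hz => ?_
  · rintro _ ⟨x, hx, rfl⟩
    exact funext fun i => apply_contractToBase A.rowForm i hx
  · refine smul_mem_of_mem_minorPowIdeal (fun e => ?_) hr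
    rw [pow_succ, mul_smul]
    exact Submodule.smul_mem _ _ (A.det_smul_mem_map_contractToBase e hz)

end Matrix

end Cramer

/-- **Proposition (kernel of the Jacobian is generated by Cramer-rule vectors).**
Let `R = ℂ⟦x₁,…,xₙ⟧`, `1 ≤ k < n`, `A` a `k × n` matrix over `R`, and
`I_k(A)` the ideal of its `k × k` minors; assume `dim R/I_k(A) = k - 1`.
For each strictly increasing `e : Fin (k+1) ↪o Fin n` (i.e. each subset
`S = {j₀ < ⋯ < j_k}` of the columns), let `v_S ∈ Rⁿ` be the vector whose
`e s`-th entry is `(-1)^s · det(A_S^s)`, where `A_S^s` is the `k × k`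
submatrix of `A` on the columns of `S` other than `e s`, and whose other
entries vanish. Then `ker(A : Rⁿ → R^k)` is generated by the `v_S`. -/
theorem kernel_of_jacobian_eq_span_cramer_vectors
    (n k : ℕ) (hk : 1 ≤ k) (hkn : k < n)
    (A : Matrix (Fin k) (Fin n) (MvPowerSeries (Fin n) ℂ))
    (Ik : Ideal (MvPowerSeries (Fin n) ℂ))
    (hIk : Ik = Ideal.span
      {d : MvPowerSeries (Fin n) ℂ | ∃ c : Fin k ↪o Fin n, d = (A.submatrix id c).det})
    (hdim : ringKrullDim (MvPowerSeries (Fin n) ℂ ⧸ Ik) =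
      ((k - 1 : ℕ) : WithBot (WithTop ℕ))) :
    LinearMap.ker A.mulVecLin =
      Submodule.span (MvPowerSeries (Fin n) ℂ)
        (Set.range fun e : Fin (k + 1) ↪o Fin n =>
          ∑ s : Fin (k + 1),
            ((-1 : MvPowerSeries (Fin n) ℂ) ^ (s : ℕ) *
                (A.submatrix id fun i => e (s.succAbove i)).det) •
              (Pi.single (e s) 1 : Fin n → MvPowerSeries (Fin n) ℂ)) := by
  refine A.ker_mulVecLin_eq_span_cramerVector hkn (fun N hN => ?_) ?_
  · rw [MvPowerSeries.isUnit_iff_constantCoeff, map_natCast, isUnit_iff_ne_zero]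
    exact_mod_cast hN
  · have hdepth := MvPowerSeries.extVanishing_maximalIdeal ℂ n
    refine ExtVanishing.of_ringKrullDim_le (d := k - 1) (hdepth.mono (by lia)) fun P hP hle => ?_
    refine le_trans ?_ hdim.le
    refine ringKrullDim_le_of_surjective (Ideal.Quotient.factor ?_)
      (Ideal.Quotient.factor_surjective _)
    rw [hIk, Ideal.span_le]
    rintro _ ⟨e, rfl⟩
    exact hP.mem_of_pow_mem _ (hle (Ideal.subset_span ⟨e, rfl⟩))
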